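/- arXiv:1202.6456 — 8 statements merged into one kernel-verified Lean document; each statement's English description precedes it below -/
import Mathlib

section
/- Let φ = (1+√5)/2 be the golden ratio. For every real number c with 1 < c < 2, one has max((c-1)/c, max(c-1, 1/c)) ≥ φ - 1, and equality holds if and only if c = φ. (This is the optimization in the proof of Theorem 1, Case 1: the exponents (c-1)/c, c-1, 1/c governing the expected costs of Alice and Bob are simultaneously minimized in the worst case by choosing c equal to the golden ratio, yielding the exponent φ - 1 ≈ 0.62.) -/
/-- The optimization in the proof of Theorem 1, Case 1: for every `c` with
`1 < c < 2`, the maximum of the cost exponents `(c-1)/c`, `c-1`, `1/c` is at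
least `φ - 1`, with equality exactly when `c` equals the golden ratio `φ`. -/
theorem stmt_0 (φ : ℝ) (hφ : φ = (1 + Real.sqrt 5) / 2)
    (c : ℝ) (hc1 : 1 < c) (hc2 : c < 2) :
    φ - 1 ≤ max ((c - 1) / c) (max (c - 1) (1 / c)) ∧
      (max ((c - 1) / c) (max (c - 1) (1 / c)) = φ - 1 ↔ c = φ) := by
  have h5 : Real.sqrt 5 * Real.sqrt 5 = 5 := Real.mul_self_sqrt (by norm_num)
  have h50 : 0 ≤ Real.sqrt 5 := Real.sqrt_nonneg 5
  have hsq : φ * φ = φ + 1 := by rw [hφ]; linarith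
  have hpos : 0 < φ := by rw [hφ]; linarith
  have hinv : 1 / φ = φ - 1 := by
    rw [div_eq_iff hpos.ne']
    linarith
  have hc : 0 < c := by linarith
  refine ⟨?_, ?_, ?_⟩
  · rcases le_total φ c with h | h
    · exact le_max_of_le_right (le_max_of_le_left (by linarith))
    · refine le_max_of_le_right (le_max_of_le_right ?_)
      rw [← hinv]
      exact one_div_le_one_div_of_le hc h
  · intro h
    have h1 : c - 1 ≤ φ - 1 := h ▸ le_max_of_le_right (le_max_left _ _)
    have h2 : 1 / c ≤ φ - 1 := h ▸ le_max_of_le_right (le_max_right _ _)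
    rw [← hinv] at h2
    have h3 : φ ≤ c := (one_div_le_one_div hc hpos).1 h2
    linarith
  · intro h
    subst h
    rw [hinv, max_self]
    apply max_eq_right
    exact div_le_self (by linarith) hc1.le
end

section
/- (Lemma 1: non-send-blocking rounds of the 3-Player Scenario Protocol.) Fix an integer i ≥ 2 and a real c with 1 < c ≤ 2. Let s be a natural number with (s : ℝ) ≥ 2^{ci}, let p_A = 2/2^i and p_B = 2/2^{(c-1)i}, and let q : Fin s → ℝ take values in {0,1} with ∑_{j} q_j > s/2. Then ∏_{j=1}^{s} (1 - p_A · p_B · q_j) < e^{-2}. (The product equals the probability that Bob fails to receive the message in a round where Carol blocks fewer than half the Send-Phase slots, since in each slot Alice sends with probability p_A, Bob listens with probability p_B, and q_j = 1 exactly when Carol does not block slot j.) -/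
/-- Lemma 1: in a non-send-blocking round `i ≥ 2` of the 3-Player Scenario
Protocol with parameter `1 < c ≤ 2`, where the Send Phase has `s ≥ 2^{c i}`
slots, Alice sends with probability `p_A = 2/2^i`, Bob listens with
probability `p_B = 2/2^{(c-1)i}`, and Carol leaves more than half the slots
unblocked (`q j = 1` iff slot `j` is unblocked), the probability that Bob
fails to receive the message, `∏ j, (1 - p_A p_B q j)`, is less than `e⁻²`. -/
theorem stmt_2 (i : ℕ) (hi : 2 ≤ i) (c : ℝ) (hc1 : 1 < c) (hc2 : c ≤ 2)
    (s : ℕ) (hs : (s : ℝ) ≥ (2 : ℝ) ^ (c * (i : ℝ)))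
    (pA pB : ℝ) (hpA : pA = 2 / 2 ^ i)
    (hpB : pB = 2 / (2 : ℝ) ^ ((c - 1) * (i : ℝ)))
    (q : Fin s → ℝ) (hq : ∀ j, q j = 0 ∨ q j = 1)
    (hsum : ∑ j, q j > (s : ℝ) / 2) :
    ∏ j, (1 - pA * pB * q j) < Real.exp (-2) := by
  have h2i : (2 : ℝ) ^ (c * (i : ℝ)) = 2 ^ i * (2 : ℝ) ^ ((c - 1) * (i : ℝ)) := by
    rw [← Real.rpow_natCast 2 i, ← Real.rpow_add (by norm_num)]
    congr 1
    ring
  have hA : (4 : ℝ) ≤ 2 ^ i := by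
    calc (4 : ℝ) = 2 ^ 2 := by norm_num
      _ ≤ 2 ^ i := pow_le_pow_right₀ (by norm_num) hi
  have hB : (1 : ℝ) ≤ (2 : ℝ) ^ ((c - 1) * (i : ℝ)) :=
    Real.one_le_rpow (by norm_num) (mul_nonneg (by linarith) (Nat.cast_nonneg i))
  have hT : (4 : ℝ) ≤ (2 : ℝ) ^ (c * (i : ℝ)) := by
    rw [h2i]; nlinarith
  have hp : pA * pB = 4 / (2 : ℝ) ^ (c * (i : ℝ)) := by
    rw [hpA, hpB, h2i, div_mul_div_comm]; norm_num
  generalize (2 : ℝ) ^ (c * (i : ℝ)) = T at hs hT hp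
  have hT0 : 0 < T := by linarith
  have hp0 : 0 < pA * pB := by rw [hp]; positivity
  have hp1 : pA * pB ≤ 1 := by rw [hp, div_le_one hT0]; exact hT
  have hpT : pA * pB * T = 4 := by rw [hp]; field_simp
  generalize pA * pB = p at hp0 hp1 hpT
  calc ∏ j, (1 - p * q j) ≤ ∏ j, Real.exp (-(p * q j)) := by
        apply Finset.prod_le_prod
        · intro j _
          rcases hq j with h | h <;> rw [h] <;> linarith
        · intro j _
          have := Real.add_one_le_exp (-(p * q j))
          linarith
    _ = Real.exp (-(p * ∑ j, q j)) := by
        rw [← Real.exp_sum, Finset.sum_neg_distrib, Finset.mul_sum]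
    _ < Real.exp (-2) := by
        apply Real.exp_lt_exp.mpr
        have h1 : p * ((s : ℝ) / 2) < p * ∑ j, q j := mul_lt_mul_of_pos_left hsum hp0
        have h2 : p * T ≤ p * s := mul_le_mul_of_nonneg_left hs hp0.le
        linarith
end

section
/- (Lemma 6: non-send-blocking rounds of Local Broadcast.) Let φ = (1+√5)/2. Let n ≥ 3 be a natural number, let i be a natural number with (2:ℝ)^i ≥ 4 ln n, let p_A = 3 ln n / 2^i and p_b = 2 / 2^{(φ-1)i}, let s be a natural number with (s:ℝ) ≥ 2^{φ i}, and let q : Fin s → ℝ take values in {0,1} with ∑_j q_j > s/2. Then ∏_{j=1}^{s} (1 − p_A · p_b · q_j) < n^{-3}, and consequently n · ∏_{j=1}^{s} (1 − p_A · p_b · q_j) < n^{-2}. (The product is the probability that a fixed correct receiver misses the message in a non-send-blocking round; the union bound over at most n receivers shows that the probability that at least one correct receiver misses the message is less than 1/n².) -/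
/-- Lemma 6: in a non-send-blocking round of Local Broadcast with `n ≥ 3`
receivers, round index `i` with `2^i ≥ 4 ln n`, sending probability
`p_A = 3 ln n / 2^i`, listening probability `p_b = 2/2^{(φ-1)i}`, and
`s ≥ 2^{φ i}` slots of which more than half are unjammed, the probability
`∏ j, (1 - p_A p_b q j)` that a fixed correct receiver misses the message is
less than `1/n³`; by the union bound, `n` times it is less than `1/n²`. -/
theorem stmt_9 (φ : ℝ) (hφ : φ = (1 + Real.sqrt 5) / 2)
    (n : ℕ) (hn : 3 ≤ n) (i : ℕ) (hi : (2 : ℝ) ^ i ≥ 4 * Real.log n)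
    (pA pb : ℝ) (hpA : pA = 3 * Real.log n / 2 ^ i)
    (hpb : pb = 2 / (2 : ℝ) ^ ((φ - 1) * (i : ℝ)))
    (s : ℕ) (hs : (s : ℝ) ≥ (2 : ℝ) ^ (φ * (i : ℝ)))
    (q : Fin s → ℝ) (hq : ∀ j, q j = 0 ∨ q j = 1)
    (hsum : ∑ j, q j > (s : ℝ) / 2) :
    (∏ j, (1 - pA * pb * q j)) < 1 / (n : ℝ) ^ 3 ∧
    (n : ℝ) * ∏ j, (1 - pA * pb * q j) < 1 / (n : ℝ) ^ 2 := by
  have hn' : (3 : ℝ) ≤ n := by exact_mod_cast hn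
  have hn0 : (0 : ℝ) < n := by linarith
  have hlog : 1 < Real.log n := by
    rw [Real.lt_log_iff_exp_lt hn0]
    have := Real.exp_one_lt_d9
    linarith
  have hi2 : 2 ≤ i := by
    by_contra h
    have h1 : i ≤ 1 := by omega
    have : (2 : ℝ) ^ i ≤ 2 ^ 1 := pow_le_pow_right₀ (by norm_num) h1
    linarith
  have hi2' : (2 : ℝ) ≤ i := by exact_mod_cast hi2
  have h5 : (2 : ℝ) ≤ Real.sqrt 5 := Real.le_sqrt_of_sq_le (by norm_num)
  have hexp : 1 ≤ (φ - 1) * (i : ℝ) := by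
    have : (1 / 2 : ℝ) ≤ φ - 1 := by rw [hφ]; linarith
    nlinarith
  have hB2 : (2 : ℝ) ≤ (2 : ℝ) ^ ((φ - 1) * (i : ℝ)) := by
    have := Real.rpow_le_rpow_of_exponent_le (x := 2) (by norm_num) hexp
    rwa [Real.rpow_one] at this
  have hmul : (2 : ℝ) ^ (φ * (i : ℝ)) = 2 ^ i * (2 : ℝ) ^ ((φ - 1) * (i : ℝ)) := by
    rw [← Real.rpow_natCast, ← Real.rpow_add (by norm_num)]
    congr 1
    ring
  have hA0 : (0 : ℝ) < 2 ^ i := by positivity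
  have hpA0 : 0 < pA := by rw [hpA]; positivity
  have hpA1 : pA ≤ 1 := by rw [hpA, div_le_one hA0]; linarith
  have hpb0 : 0 < pb := by rw [hpb]; positivity
  have hpb1 : pb ≤ 1 := by rw [hpb, div_le_one (by linarith)]; exact hB2
  have hp0 : 0 < pA * pb := mul_pos hpA0 hpb0
  have hp1 : pA * pb ≤ 1 := mul_le_one₀ hpA1 hpb0.le hpb1
  have key : 3 * Real.log n ≤ pA * pb * ((s : ℝ) / 2) := by
    have h1 : pA * pb * ((2 : ℝ) ^ (φ * (i : ℝ)) / 2) = 3 * Real.log n := by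
      rw [hmul, hpA, hpb]
      have : (2 : ℝ) ^ ((φ - 1) * (i : ℝ)) ≠ 0 := by positivity
      generalize (2 : ℝ) ^ ((φ - 1) * (i : ℝ)) = B at *
      field_simp
    rw [← h1]
    gcongr
  have hprod : (∏ j, (1 - pA * pb * q j)) ≤ Real.exp (-(pA * pb * ∑ j, q j)) := by
    rw [Finset.mul_sum, ← Finset.sum_neg_distrib, Real.exp_sum]
    apply Finset.prod_le_prod
    · intro j _
      rcases hq j with h | h <;> rw [h] <;> linarith
    · intro j _
      exact Real.one_sub_le_exp_neg _
  have hmain : (∏ j, (1 - pA * pb * q j)) < 1 / (n : ℝ) ^ 3 := by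
    have h1 : 1 / (n : ℝ) ^ 3 = Real.exp (-(3 * Real.log n)) := by
      rw [Real.exp_neg, one_div, mul_comm, Real.exp_mul, Real.exp_log hn0]
      norm_cast
    rw [h1]
    refine hprod.trans_lt (Real.exp_lt_exp.mpr ?_)
    have := mul_lt_mul_of_pos_left hsum hp0
    linarith
  refine ⟨hmain, ?_⟩
  have := mul_lt_mul_of_pos_left hmain hn0
  refine this.trans_eq ?_
  field_simp
end

section
/- (Lemma 7: non-nack-blocking rounds of Local Broadcast.) Let n ≥ 3 be a natural number, let i be a natural number with (2:ℝ)^i ≥ 4 ln n, let p = 4 ln n / 2^i, let s be a natural number with (s:ℝ) ≥ 2^i, and let q : Fin s → ℝ take values in {0,1} with ∑_j q_j > s/2. Then ∏_{j=1}^{s} (1 − p · q_j) < n^{-2}. (The product is the probability that Alice retransmits in round i+1 given that all correct receivers have heard the message by round i and the adversary interferes in fewer than half of the Probabilistic Nack Phase slots, since Alice listens in each such slot independently with probability p and terminates upon hearing a clear slot.) -/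
/-- Lemma 7: in a non-nack-blocking round of Local Broadcast with `n ≥ 3`
receivers, round index `i` with `2^i ≥ 4 ln n`, listening probability
`p = 4 ln n / 2^i`, and `s ≥ 2^i` Probabilistic-Nack-Phase slots of which more
than half are clear, the probability `∏ j, (1 - p q j)` that Alice retransmits
in round `i+1` is less than `1/n²`. -/
theorem stmt_10 (n : ℕ) (hn : 3 ≤ n) (i : ℕ) (hi : (2 : ℝ) ^ i ≥ 4 * Real.log n)
    (p : ℝ) (hp : p = 4 * Real.log n / 2 ^ i)
    (s : ℕ) (hs : (s : ℝ) ≥ (2 : ℝ) ^ i)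
    (q : Fin s → ℝ) (hq : ∀ j, q j = 0 ∨ q j = 1)
    (hsum : ∑ j, q j > (s : ℝ) / 2) :
    ∏ j, (1 - p * q j) < 1 / (n : ℝ) ^ 2 := by
  have hn1 : (1 : ℝ) < n := by exact_mod_cast (by omega : 1 < n)
  have hn0 : (0 : ℝ) < n := by linarith
  have hL : 0 < Real.log n := Real.log_pos hn1
  have h2 : (0 : ℝ) < 2 ^ i := by positivity
  have hp0 : 0 < p := by rw [hp]; positivity
  have hp1 : p ≤ 1 := by rw [hp, div_le_one h2]; exact hi
  have hps : p * 2 ^ i = 4 * Real.log n := by rw [hp]; field_simp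
  have h1 : ∏ j, (1 - p * q j) ≤ ∏ j, Real.exp (-(p * q j)) := by
    apply Finset.prod_le_prod
    · intro j _
      rcases hq j with h | h <;> rw [h] <;> linarith
    · intro j _
      have := Real.add_one_le_exp (-(p * q j))
      linarith
  have h3 : ∏ j, Real.exp (-(p * q j)) = Real.exp (-(p * ∑ j, q j)) := by
    rw [← Real.exp_sum, Finset.sum_neg_distrib, Finset.mul_sum]
  have h4 : 1 / (n : ℝ) ^ 2 = Real.exp (-(2 * Real.log n)) := by
    rw [Real.exp_neg, two_mul, Real.exp_add, Real.exp_log hn0, one_div, sq]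
  rw [h4]
  refine (h1.trans_eq h3).trans_lt (Real.exp_lt_exp.mpr ?_)
  have h5 : p * ((s : ℝ) / 2) < p * ∑ j, q j := mul_lt_mul_of_pos_left hsum hp0
  have h6 : p * 2 ^ i ≤ p * s := mul_le_mul_of_nonneg_left hs hp0.le
  linarith
end

section
/- (Series bounds in Lemma 8: Local Broadcast cost with no blocking.) Let φ = (1+√5)/2. There exists a constant C > 0 such that for every natural number n ≥ 3, with d = ⌈log₂(4 ln n)⌉, the following two series converge and satisfy: ∑_{i=d}^{∞} n^{-2(i-d)} · (3 ln n · 2^{(φ-1)i} + 2 · 2^{(φ-1)i+1} + 4) ≤ C · (ln n)^{φ}, and ∑_{i=d}^{∞} n^{-2(i-d)} · (2^{i+1} + 2^{i} + 2 · 2^{(φ-1)i+1}) ≤ C · ln n. (The first series bounds Alice's expected cost, O(ln^{φ} n), and the second bounds each correct receiver's expected cost, O(ln n), in Local Broadcast when there are no send-blocking and no nack-blocking rounds.) -/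
theorem aux_series (r B : ℝ) (hr0 : 0 ≤ r) (hr : r ≤ 1 / 4) (hB : 0 ≤ B) (f : ℕ → ℝ)
    (h0 : ∀ k, 0 ≤ f k) (hf : ∀ k, f k ≤ B * 2 ^ k) :
    (Summable fun k : ℕ => r ^ k * f k) ∧ (∑' k : ℕ, r ^ k * f k) ≤ 2 * B := by
  have hle : ∀ k, r ^ k * f k ≤ B * (1 / 2) ^ k := by
    intro k
    calc r ^ k * f k ≤ (1 / 4) ^ k * (B * 2 ^ k) :=
          mul_le_mul (pow_le_pow_left₀ hr0 hr k) (hf k) (h0 k) (by positivity)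
      _ = B * ((1 / 4) * 2) ^ k := by rw [mul_pow]; ring
      _ = B * (1 / 2) ^ k := by norm_num
  have hs : Summable fun k : ℕ => B * (1 / 2 : ℝ) ^ k := summable_geometric_two.mul_left B
  have hs2 : Summable fun k : ℕ => r ^ k * f k :=
    Summable.of_nonneg_of_le (fun k => mul_nonneg (pow_nonneg hr0 k) (h0 k)) hle hs
  refine ⟨hs2, ?_⟩
  calc (∑' k : ℕ, r ^ k * f k) ≤ ∑' k : ℕ, B * (1 / 2 : ℝ) ^ k := hs2.tsum_le_tsum hle hs
    _ = 2 * B := by rw [tsum_mul_left, tsum_geometric_two]; ring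

/-- Series bounds in Lemma 8 (Local Broadcast cost with no blocking): there is
a constant `C > 0` such that for all `n ≥ 3`, with `d = ⌈log₂ (4 ln n)⌉` and
writing `i = d + k`, Alice's expected-cost series
`∑_{i=d}^∞ n^{-2(i-d)} (3 ln n · 2^{(φ-1)i} + 2·2^{(φ-1)i+1} + 4)` converges
and is at most `C (ln n)^φ`, and each correct receiver's expected-cost series
`∑_{i=d}^∞ n^{-2(i-d)} (2^{i+1} + 2^i + 2·2^{(φ-1)i+1})` converges and is at
most `C ln n`. -/
theorem stmt_11 (φ : ℝ) (hφ : φ = (1 + Real.sqrt 5) / 2) :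
    ∃ C > 0, ∀ n : ℕ, 3 ≤ n → ∀ d : ℕ, d = ⌈Real.logb 2 (4 * Real.log n)⌉₊ →
      (Summable fun k : ℕ => (((n : ℝ) ^ 2)⁻¹) ^ k *
          (3 * Real.log n * (2 : ℝ) ^ ((φ - 1) * ((d : ℝ) + k)) +
            2 * (2 : ℝ) ^ ((φ - 1) * ((d : ℝ) + k) + 1) + 4)) ∧
      (∑' k : ℕ, (((n : ℝ) ^ 2)⁻¹) ^ k *
          (3 * Real.log n * (2 : ℝ) ^ ((φ - 1) * ((d : ℝ) + k)) +
            2 * (2 : ℝ) ^ ((φ - 1) * ((d : ℝ) + k) + 1) + 4)) ≤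
        C * Real.log n ^ φ ∧
      (Summable fun k : ℕ => (((n : ℝ) ^ 2)⁻¹) ^ k *
          ((2 : ℝ) ^ (d + k + 1) + (2 : ℝ) ^ (d + k) +
            2 * (2 : ℝ) ^ ((φ - 1) * ((d : ℝ) + k) + 1))) ∧
      (∑' k : ℕ, (((n : ℝ) ^ 2)⁻¹) ^ k *
          ((2 : ℝ) ^ (d + k + 1) + (2 : ℝ) ^ (d + k) +
            2 * (2 : ℝ) ^ ((φ - 1) * ((d : ℝ) + k) + 1))) ≤
        C * Real.log n := by
  have h5 : Real.sqrt 5 ^ 2 = 5 := Real.sq_sqrt (by norm_num)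
  have h5n := Real.sqrt_nonneg 5
  have hx0 : 0 ≤ φ - 1 := by rw [hφ]; nlinarith
  have hx1 : φ - 1 ≤ 1 := by rw [hφ]; nlinarith
  refine ⟨120, by norm_num, ?_⟩
  intro n hn d hd
  have hn' : (3 : ℝ) ≤ n := by exact_mod_cast hn
  have hL : 1 ≤ Real.log n := by
    rw [Real.le_log_iff_exp_le (by linarith)]
    linarith [Real.exp_one_lt_d9]
  have hd2 : (2 : ℝ) ^ d ≤ 8 * Real.log n := by
    have h1 : 0 ≤ Real.logb 2 (4 * Real.log n) :=
      Real.logb_nonneg (by norm_num) (by linarith)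
    have h2 := (Nat.ceil_lt_add_one h1).le
    rw [← hd] at h2
    have h3 : (2 : ℝ) ^ (d : ℝ) ≤ 2 ^ (Real.logb 2 (4 * Real.log n) + 1) :=
      Real.rpow_le_rpow_of_exponent_le (by norm_num) h2
    rw [Real.rpow_natCast, Real.rpow_add (by norm_num),
      Real.rpow_logb (by norm_num) (by norm_num) (by linarith), Real.rpow_one] at h3
    linarith
  generalize hLdef : Real.log n = L at *
  have hLx : 1 ≤ L ^ (φ - 1) := Real.one_le_rpow hL hx0
  have hLxL : L ^ (φ - 1) ≤ L := by
    simpa using Real.rpow_le_rpow_of_exponent_le hL hx1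
  have hLφ : L ^ φ = L * L ^ (φ - 1) := by
    rw [Real.rpow_sub_one (by linarith)]; field_simp
  have key : ∀ k : ℕ, (2 : ℝ) ^ ((φ - 1) * ((d : ℝ) + k)) ≤ 8 * L ^ (φ - 1) * 2 ^ k := by
    intro k
    have e : (2 : ℝ) ^ ((φ - 1) * ((d : ℝ) + k)) = (2 ^ d) ^ (φ - 1) * (2 ^ k) ^ (φ - 1) := by
      rw [← Real.mul_rpow (by positivity) (by positivity), ← pow_add, ← Real.rpow_natCast,
        ← Real.rpow_mul (by norm_num)]
      push_cast
      ring_nf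
    have a1 : ((2 : ℝ) ^ d) ^ (φ - 1) ≤ 8 * L ^ (φ - 1) := by
      calc ((2 : ℝ) ^ d) ^ (φ - 1) ≤ (8 * L) ^ (φ - 1) :=
            Real.rpow_le_rpow (by positivity) hd2 hx0
        _ = 8 ^ (φ - 1) * L ^ (φ - 1) := Real.mul_rpow (by norm_num) (by linarith)
        _ ≤ 8 * L ^ (φ - 1) := by
          gcongr
          simpa using Real.rpow_le_rpow_of_exponent_le (x := (8 : ℝ)) (by norm_num) hx1
    have a2 : ((2 : ℝ) ^ k) ^ (φ - 1) ≤ 2 ^ k := by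
      simpa using Real.rpow_le_rpow_of_exponent_le (x := (2 : ℝ) ^ k)
        (one_le_pow₀ (by norm_num)) hx1
    rw [e]
    exact mul_le_mul a1 a2 (by positivity) (by positivity)
  have key1 : ∀ k : ℕ, (2 : ℝ) ^ ((φ - 1) * ((d : ℝ) + k) + 1)
      = 2 * (2 : ℝ) ^ ((φ - 1) * ((d : ℝ) + k)) := by
    intro k
    rw [Real.rpow_add (by norm_num), Real.rpow_one, mul_comm]
  have hr0 : 0 ≤ ((n : ℝ) ^ 2)⁻¹ := by positivity
  have hr : ((n : ℝ) ^ 2)⁻¹ ≤ 1 / 4 := by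
    rw [one_div]
    exact inv_anti₀ (by norm_num) (by nlinarith)
  have A := aux_series _ (60 * L ^ φ) hr0 hr (by positivity)
    (fun k : ℕ => 3 * L * (2 : ℝ) ^ ((φ - 1) * ((d : ℝ) + k)) +
            2 * (2 : ℝ) ^ ((φ - 1) * ((d : ℝ) + k) + 1) + 4) (fun k => by positivity) (by
      intro k
      have hk : (1 : ℝ) ≤ 2 ^ k := one_le_pow₀ (by norm_num)
      have h := key k
      simp only [key1, hLφ]
      set P := (2 : ℝ) ^ ((φ - 1) * ((d : ℝ) + k))
      set X := L ^ (φ - 1)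
      have b1 : L * P ≤ L * (8 * X * 2 ^ k) := mul_le_mul_of_nonneg_left h (by linarith)
      have b3 : 1 ≤ X * 2 ^ k := one_le_mul_of_one_le_of_one_le hLx hk
      have b4 : X * 2 ^ k ≤ L * (X * 2 ^ k) := le_mul_of_one_le_left (by linarith) hL
      linarith)
  have B := aux_series _ (60 * L) hr0 hr (by positivity)
    (fun k : ℕ => (2 : ℝ) ^ (d + k + 1) + (2 : ℝ) ^ (d + k) +
            2 * (2 : ℝ) ^ ((φ - 1) * ((d : ℝ) + k) + 1)) (fun k => by positivity) (by
      intro k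
      have hk : (1 : ℝ) ≤ 2 ^ k := one_le_pow₀ (by norm_num)
      have h := key k
      simp only [key1, pow_succ, pow_add]
      have b1 : (2 : ℝ) ^ d * 2 ^ k ≤ 8 * L * 2 ^ k :=
        mul_le_mul_of_nonneg_right hd2 (by linarith)
      have b2 : L ^ (φ - 1) * 2 ^ k ≤ L * 2 ^ k :=
        mul_le_mul_of_nonneg_right hLxL (by linarith)
      have b3 : 1 ≤ L * 2 ^ k := one_le_mul_of_one_le_of_one_le hL hk
      linarith)
  exact ⟨A.1, A.2.trans (by linarith), B.1, B.2.trans (by linarith)⟩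
end

section
/- (Core computation of Lemma 9: latency of Local Broadcast.) Let φ = (1+√5)/2. For every real number x ≥ 1, setting ρ = ⌈φ · log₂ x⌉ (a natural number), we have: (i) ∑_{i=0}^{ρ} 2^{(φ-1)i + 1} ≥ 2x, and (ii) ∑_{i=0}^{ρ} 4 · 2^{φ i + 1} ≤ 64 · x^{φ+1}. (Claim (i) shows that an adversary with budget B ≤ x cannot be active in every deterministic-phase slot of each of the first ρ+1 rounds, so all correct players terminate within ρ+1 rounds; claim (ii) bounds the total number of slots in those rounds by O(x^{φ+1}), yielding the hard latency bound of Lemma 9.) -/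
/-- Core computation of Lemma 9 (latency of Local Broadcast): for `x ≥ 1` and
`ρ = ⌈φ log₂ x⌉`, (i) the total number of deterministic-phase slots in rounds
`0, …, ρ` satisfies `∑_{i=0}^{ρ} 2^{(φ-1)i+1} ≥ 2x`, and (ii) the total number
of slots in those rounds satisfies `∑_{i=0}^{ρ} 4·2^{φ i + 1} ≤ 64 x^{φ+1}`. -/
theorem stmt_12 (φ : ℝ) (hφ : φ = (1 + Real.sqrt 5) / 2)
    (x : ℝ) (hx : 1 ≤ x) (ρ : ℕ) (hρ : ρ = ⌈φ * Real.logb 2 x⌉₊) :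
    2 * x ≤ ∑ i ∈ Finset.range (ρ + 1), (2 : ℝ) ^ ((φ - 1) * (i : ℝ) + 1) ∧
    ∑ i ∈ Finset.range (ρ + 1), 4 * (2 : ℝ) ^ (φ * (i : ℝ) + 1) ≤
      64 * x ^ (φ + 1) := by
  have h5 : Real.sqrt 5 ^ 2 = 5 := Real.sq_sqrt (by norm_num)
  have h50 : 0 ≤ Real.sqrt 5 := Real.sqrt_nonneg 5
  have hsq : φ * φ = φ + 1 := by rw [hφ]; nlinarith
  have h1 : 1 < φ := by rw [hφ]; nlinarith
  have h2 : φ < 2 := by rw [hφ]; nlinarith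
  have hx0 : 0 < x := by linarith
  have hL : 0 ≤ Real.logb 2 x := Real.logb_nonneg (by norm_num) hx
  have hxL : (2 : ℝ) ^ Real.logb 2 x = x := Real.rpow_logb (by norm_num) (by norm_num) hx0
  have hlo : φ * Real.logb 2 x ≤ ρ := by rw [hρ]; exact Nat.le_ceil _
  have hhi : (ρ : ℝ) ≤ φ * Real.logb 2 x + 1 := by
    rw [hρ]; exact (Nat.ceil_lt_add_one (by positivity)).le
  generalize Real.logb 2 x = L at *
  constructor
  · have hlast : 2 * x ≤ (2 : ℝ) ^ ((φ - 1) * (ρ : ℝ) + 1) := by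
      rw [Real.rpow_add_one (by norm_num), mul_comm, ← hxL]
      gcongr
      · norm_num
      · nlinarith [mul_le_mul_of_nonneg_left hlo (by linarith : 0 ≤ φ - 1)]
    refine hlast.trans ?_
    exact Finset.single_le_sum (f := fun i : ℕ => (2 : ℝ) ^ ((φ - 1) * (i : ℝ) + 1))
      (fun i _ => by positivity) (Finset.mem_range.2 (Nat.lt_succ_self ρ))
  · have hq2 : 2 ≤ (2 : ℝ) ^ φ := by
      simpa using Real.rpow_le_rpow_of_exponent_le (x := 2) (by norm_num) h1.le
    have hq4 : (2 : ℝ) ^ φ ≤ 4 := by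
      have := Real.rpow_le_rpow_of_exponent_le (x := 2) (by norm_num) h2.le
      norm_num at this
      exact this
    have hterm : ∀ i : ℕ, 4 * (2 : ℝ) ^ (φ * (i : ℝ) + 1) = 8 * ((2 : ℝ) ^ φ) ^ i := by
      intro i
      rw [Real.rpow_add_one (by norm_num), Real.rpow_mul (by norm_num), Real.rpow_natCast]
      ring
    have hpow : ((2 : ℝ) ^ φ) ^ ρ ≤ x ^ (φ + 1) * (2 : ℝ) ^ φ := by
      rw [← Real.rpow_natCast, ← Real.rpow_mul (by norm_num), ← hxL,
        ← Real.rpow_mul (by norm_num), ← Real.rpow_add (by norm_num)]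
      apply Real.rpow_le_rpow_of_exponent_le (by norm_num)
      have := mul_le_mul_of_nonneg_left hhi (by linarith : 0 ≤ φ)
      calc φ * (ρ : ℝ) ≤ φ * (φ * L + 1) := this
        _ = (φ * φ) * L + φ := by ring
        _ = L * (φ + 1) + φ := by rw [hsq]; ring
    simp only [hterm]
    rw [← Finset.mul_sum]
    have hg := geom_sum_mul ((2 : ℝ) ^ φ) (ρ + 1)
    rw [pow_succ] at hg
    have hX : 0 < x ^ (φ + 1) := by positivity
    generalize (2 : ℝ) ^ φ = q at *
    generalize x ^ (φ + 1) = X at *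
    generalize ∑ i ∈ Finset.range (ρ + 1), q ^ i = S at *
    have e1 : q ^ ρ * q ≤ X * q * q := mul_le_mul_of_nonneg_right hpow (by linarith)
    have e2 : q * q ≤ 8 * (q - 1) := by nlinarith
    have e3 : X * (q * q) ≤ X * (8 * (q - 1)) := mul_le_mul_of_nonneg_left e2 hX.le
    have e4 : S * (q - 1) ≤ (8 * X) * (q - 1) := by linarith
    have e5 : S ≤ 8 * X := le_of_mul_le_mul_right e4 (by linarith)
    linarith
end

section
/- (Favourability inequality from the cost analysis of Theorem 3.) Let φ = (1+√5)/2. For all real numbers t ≥ 3 and β with β ≥ t · (ln t)^{φ+1}, one has t^{2-φ} · β^{φ-1} · ln t + t · (ln t)^{φ} ≤ 2β. (Hence if the adversarial nodes are active for β = ω(t ln^{φ+1} t) slots, then each correct node's expected cost O(t^{2-φ} β^{φ-1} ln t + t ln^{φ} t) is o(β), i.e., asymptotically less than the adversary's cost, establishing favourability of the reliable broadcast protocol.) -/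
/-- Favourability inequality from the cost analysis of Theorem 3: for `t ≥ 3`
and `β ≥ t (ln t)^{φ+1}`,
`t^{2-φ} β^{φ-1} ln t + t (ln t)^φ ≤ 2β`. -/
theorem stmt_15 (φ : ℝ) (hφ : φ = (1 + Real.sqrt 5) / 2)
    (t β : ℝ) (ht : 3 ≤ t) (hβ : t * Real.log t ^ (φ + 1) ≤ β) :
    t ^ (2 - φ) * β ^ (φ - 1) * Real.log t + t * Real.log t ^ φ ≤ 2 * β := by
  have h5 : Real.sqrt 5 ^ 2 = 5 := Real.sq_sqrt (by norm_num)
  have h50 : 0 ≤ Real.sqrt 5 := Real.sqrt_nonneg 5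
  have hφ2 : φ ≤ 2 := by nlinarith
  have hprod : (φ + 1) * (2 - φ) = 1 := by rw [hφ]; nlinarith
  have ht0 : 0 < t := by linarith
  have hL : 1 ≤ Real.log t := by
    rw [Real.le_log_iff_exp_le ht0]
    linarith [Real.exp_one_lt_d9]
  have hL0 : 0 ≤ Real.log t := by linarith
  have hpos : 0 < t * Real.log t ^ (φ + 1) := by positivity
  have hβ0 : 0 < β := by linarith
  have h1 : t ^ (2 - φ) * Real.log t ≤ β ^ (2 - φ) := by
    have h := Real.rpow_le_rpow hpos.le hβ (by linarith : 0 ≤ 2 - φ)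
    rwa [Real.mul_rpow ht0.le (by positivity), ← Real.rpow_mul hL0, hprod,
      Real.rpow_one] at h
  have h2 : β ^ (2 - φ) * β ^ (φ - 1) = β := by
    rw [← Real.rpow_add hβ0]
    ring_nf
    exact Real.rpow_one β
  have h3 : t ^ (2 - φ) * Real.log t * β ^ (φ - 1) ≤ β ^ (2 - φ) * β ^ (φ - 1) :=
    mul_le_mul_of_nonneg_right h1 (by positivity)
  have h4 : t * Real.log t ^ φ ≤ t * Real.log t ^ (φ + 1) :=
    mul_le_mul_of_nonneg_left (Real.rpow_le_rpow_of_exponent_le hL (by linarith)) ht0.le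
  nlinarith
end

section
/- (Combinatorial structure underlying the grid reliable-broadcast induction, Lemma 14 / Bhandari–Vaidya.) Let r ≥ 1, a, b, z be integers with 0 ≤ z ≤ r, and let p = (a − r + z, b + r + 1) ∈ ℤ². Define A = {(x,y) ∈ ℤ² : a−r ≤ x ≤ a+z, b+1 ≤ y ≤ b+r}, B = {(x,y) ∈ ℤ² : a+z+1 ≤ x ≤ a+r, b+1 ≤ y ≤ b+r}, and B′ = {(x−r, y+r) : (x,y) ∈ B}. Then: (i) A and B are disjoint and both contained in the L∞-ball of radius r centred at (a,b); (ii) every point of A ∪ B′ is within L∞-distance r of p, and every point q of B is within L∞-distance r of its translate (the sister node) q − (r, −r) ∈ B′; (iii) A, B, B′ are pairwise disjoint and A ∪ B ∪ B′ ∪ {p} is contained in the L∞-ball of radius r centred at (a, b+r+1); and (iv) |A| = r(r+z+1) and |B| = r(r−z), so |A| + |B| = r(2r+1). (These r(2r+1) node-disjoint one-hop paths q → p with q ∈ A and two-hop paths q → q′ → p with q ∈ B, q′ ∈ B′ its sister, all lie within the single neighbourhood N(a, b+r+1) and connect N(a,b) to p.) -/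
theorem rect_ncard (x0 x1 y0 y1 : ℤ) (hx : x0 ≤ x1 + 1) (hy : y0 ≤ y1 + 1) :
    (({u : ℤ × ℤ | x0 ≤ u.1 ∧ u.1 ≤ x1 ∧ y0 ≤ u.2 ∧ u.2 ≤ y1} : Set (ℤ × ℤ)).ncard : ℤ)
      = (x1 + 1 - x0) * (y1 + 1 - y0) := by
  have h : ({u : ℤ × ℤ | x0 ≤ u.1 ∧ u.1 ≤ x1 ∧ y0 ≤ u.2 ∧ u.2 ≤ y1} : Set (ℤ × ℤ))
      = ((Finset.Icc x0 x1 ×ˢ Finset.Icc y0 y1 : Finset (ℤ × ℤ)) : Set (ℤ × ℤ)) := by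
    ext u
    simp only [Set.mem_setOf_eq, Finset.mem_coe, Finset.mem_product, Finset.mem_Icc, and_assoc]
  rw [h, Set.ncard_coe_finset, Finset.card_product, Int.card_Icc, Int.card_Icc]
  push_cast
  rw [Int.toNat_of_nonneg (by omega), Int.toNat_of_nonneg (by omega)]

/-- Combinatorial structure underlying the grid reliable-broadcast induction
(Lemma 14 / Bhandari–Vaidya). With `p = (a - r + z, b + r + 1)`,
`A`, `B` the two rectangles of nodes in `N(a,b)` and `B'` the translate of `B`
by `(-r, r)`, and with L∞-distance `max |x₁-x₂| |y₁-y₂|`: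
(i) `A` and `B` are disjoint subsets of the radius-`r` L∞-ball about `(a,b)`;
(ii) every point of `A ∪ B'` is within distance `r` of `p`, and every `q ∈ B`
is within distance `r` of its sister node `(q.1 - r, q.2 + r) ∈ B'`;
(iii) `A, B, B'` are pairwise disjoint and `A ∪ B ∪ B' ∪ {p}` lies in the
radius-`r` ball about `(a, b + r + 1)`;
(iv) `|A| = r(r+z+1)` and `|B| = r(r-z)`, so `|A| + |B| = r(2r+1)`. -/
theorem stmt_17 (r a b z : ℤ) (hr : 1 ≤ r) (hz0 : 0 ≤ z) (hzr : z ≤ r)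
    (p : ℤ × ℤ) (hp : p = (a - r + z, b + r + 1))
    (A B B' : Set (ℤ × ℤ))
    (hA : A = {u : ℤ × ℤ | a - r ≤ u.1 ∧ u.1 ≤ a + z ∧ b + 1 ≤ u.2 ∧ u.2 ≤ b + r})
    (hB : B = {u : ℤ × ℤ | a + z + 1 ≤ u.1 ∧ u.1 ≤ a + r ∧ b + 1 ≤ u.2 ∧ u.2 ≤ b + r})
    (hB' : B' = (fun u : ℤ × ℤ => (u.1 - r, u.2 + r)) '' B) :
    -- (i)
    (Disjoint A B ∧
      (∀ u ∈ A, max |u.1 - a| |u.2 - b| ≤ r) ∧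
      (∀ u ∈ B, max |u.1 - a| |u.2 - b| ≤ r)) ∧
    -- (ii)
    ((∀ u ∈ A ∪ B', max |u.1 - p.1| |u.2 - p.2| ≤ r) ∧
      (∀ u ∈ B, (u.1 - r, u.2 + r) ∈ B' ∧
        max |u.1 - (u.1 - r)| |u.2 - (u.2 + r)| ≤ r)) ∧
    -- (iii)
    ((Disjoint A B ∧ Disjoint A B' ∧ Disjoint B B') ∧
      (∀ u ∈ A ∪ B ∪ B' ∪ {p}, max |u.1 - a| |u.2 - (b + r + 1)| ≤ r)) ∧
    -- (iv)
    ((A.ncard : ℤ) = r * (r + z + 1) ∧ (B.ncard : ℤ) = r * (r - z) ∧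
      (A.ncard : ℤ) + (B.ncard : ℤ) = r * (2 * r + 1)) := by
  have mA : ∀ u : ℤ × ℤ, u ∈ A ↔
      a - r ≤ u.1 ∧ u.1 ≤ a + z ∧ b + 1 ≤ u.2 ∧ u.2 ≤ b + r := by
    intro u; rw [hA]; rfl
  have mB : ∀ u : ℤ × ℤ, u ∈ B ↔
      a + z + 1 ≤ u.1 ∧ u.1 ≤ a + r ∧ b + 1 ≤ u.2 ∧ u.2 ≤ b + r := by
    intro u; rw [hB]; rfl
  have mB' : ∀ u : ℤ × ℤ, u ∈ B' →
      a + z + 1 - r ≤ u.1 ∧ u.1 ≤ a ∧ b + 1 + r ≤ u.2 ∧ u.2 ≤ b + r + r := by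
    intro u hu
    rw [hB'] at hu
    obtain ⟨v, hv, rfl⟩ := hu
    have := (mB v).1 hv
    dsimp only
    omega
  have dAB : Disjoint A B := by
    rw [Set.disjoint_left]
    intro u h1 h2
    have := (mA u).1 h1
    have := (mB u).1 h2
    omega
  have cA : (A.ncard : ℤ) = r * (r + z + 1) := by
    rw [hA, rect_ncard _ _ _ _ (by omega) (by omega)]; ring
  have cB : (B.ncard : ℤ) = r * (r - z) := by
    rw [hB, rect_ncard _ _ _ _ (by omega) (by omega)]; ring
  have key : ∀ s t : ℤ, -r ≤ s → s ≤ r → -r ≤ t → t ≤ r → max |s| |t| ≤ r :=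
    fun s t h1 h2 h3 h4 => max_le (abs_le.2 ⟨h1, h2⟩) (abs_le.2 ⟨h3, h4⟩)
  have p1 : p.1 = a - r + z := by rw [hp]
  have p2 : p.2 = b + r + 1 := by rw [hp]
  refine ⟨⟨dAB, ?_, ?_⟩, ⟨?_, ?_⟩, ⟨⟨dAB, ?_, ?_⟩, ?_⟩, cA, cB, ?_⟩
  · intro u hu
    have := (mA u).1 hu
    apply key <;> omega
  · intro u hu
    have := (mB u).1 hu
    apply key <;> omega
  · rintro u (hu | hu)
    · have := (mA u).1 hu
      apply key <;> omega
    · have := mB' u hu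
      apply key <;> omega
  · intro u hu
    refine ⟨?_, ?_⟩
    · rw [hB']; exact ⟨u, hu, rfl⟩
    · apply key <;> omega
  · rw [Set.disjoint_left]
    intro u h1 h2
    have := (mA u).1 h1
    have := mB' u h2
    omega
  · rw [Set.disjoint_left]
    intro u h1 h2
    have := (mB u).1 h1
    have := mB' u h2
    omega
  · rintro u (((hu | hu) | hu) | hu)
    · have := (mA u).1 hu
      apply key <;> omega
    · have := (mB u).1 hu
      apply key <;> omega
    · have := mB' u hu
      apply key <;> omega
    · rw [Set.mem_singleton_iff] at hu
      subst hu
      apply key <;> omega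
  · rw [cA, cB]; ring
end
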